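/- Let M ⊂ R^n be a bounded domain with smooth boundary and u a smooth function with u = 0 on ∂M satisfying Δu + λ f(u) = 0 in M, where f is smooth with f(0)=0 and F(u) = ∫_0^u f(t)dt. Then the Pohozaev identity holds: λ n ∫_M F(u) dx + ((2−n)/2) λ ∫_M f(u)u dx = (1/2) ∫_{∂M} (x·ν)(∂_ν u)^2 dσ, where x is the position (Euler) vector field and ν the outward unit normal. -/

import Mathlib

open MeasureTheory
open scoped RealInnerProductSpace

/-- The Euclidean Laplacian `Δu = ∑ᵢ ∂²u/∂xᵢ²`. -/
noncomputable def eLap {n : ℕ} (u : EuclideanSpace ℝ (Fin n) → ℝ)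
    (x : EuclideanSpace ℝ (Fin n)) : ℝ :=
  ∑ i : Fin n, fderiv ℝ (fun y => fderiv ℝ u y (EuclideanSpace.single i 1)) x
    (EuclideanSpace.single i 1)

/-- The Euclidean divergence of a vector field `G`. -/
noncomputable def eDiv {n : ℕ}
    (G : EuclideanSpace ℝ (Fin n) → EuclideanSpace ℝ (Fin n))
    (x : EuclideanSpace ℝ (Fin n)) : ℝ :=
  ∑ i : Fin n, fderiv ℝ (fun y => G y i) x (EuclideanSpace.single i 1)

/-- The `i`-th partial derivative of a function on Euclidean space. -/
noncomputable def partialDeriv {n : ℕ} (i : Fin n) (g : EuclideanSpace ℝ (Fin n) → ℝ)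
    (x : EuclideanSpace ℝ (Fin n)) : ℝ :=
  fderiv ℝ g x (EuclideanSpace.single i 1)

section PartialDeriv

variable {n : ℕ} {g h : EuclideanSpace ℝ (Fin n) → ℝ} {x : EuclideanSpace ℝ (Fin n)}

theorem contDiff_partialDeriv (hg : ContDiff ℝ (⊤ : ℕ∞) g) (i : Fin n) :
    ContDiff ℝ (⊤ : ℕ∞) (partialDeriv i g) :=
  (hg.fderiv_right (by simp)).clm_apply contDiff_const

theorem contDiff_coord (i : Fin n) :
    ContDiff ℝ (⊤ : ℕ∞) (fun y : EuclideanSpace ℝ (Fin n) => y i) :=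
  (EuclideanSpace.proj (𝕜 := ℝ) i).contDiff

theorem partialDeriv_mul (i : Fin n) (hg : DifferentiableAt ℝ g x)
    (hh : DifferentiableAt ℝ h x) :
    partialDeriv i (fun y => g y * h y) x
      = g x * partialDeriv i h x + h x * partialDeriv i g x := by
  simp [partialDeriv, fderiv_fun_mul hg hh]

theorem partialDeriv_add (i : Fin n) (hg : DifferentiableAt ℝ g x)
    (hh : DifferentiableAt ℝ h x) :
    partialDeriv i (fun y => g y + h y) x = partialDeriv i g x + partialDeriv i h x := by
  simp [partialDeriv, fderiv_fun_add hg hh]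

theorem partialDeriv_sum {ι : Type*} (s : Finset ι) (i : Fin n)
    {g : ι → EuclideanSpace ℝ (Fin n) → ℝ} (hg : ∀ k, DifferentiableAt ℝ (g k) x) :
    partialDeriv i (fun y => ∑ k ∈ s, g k y) x = ∑ k ∈ s, partialDeriv i (g k) x := by
  simp [partialDeriv, fderiv_fun_sum (fun k _ => hg k)]

theorem partialDeriv_const_mul (i : Fin n) (c : ℝ) (hg : DifferentiableAt ℝ g x) :
    partialDeriv i (fun y => c * g y) x = c * partialDeriv i g x := by
  simp [partialDeriv, fderiv_const_mul hg]

theorem partialDeriv_coord (i k : Fin n) :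
    partialDeriv i (fun y : EuclideanSpace ℝ (Fin n) => y k) x = if k = i then 1 else 0 := by
  have : fderiv ℝ (fun y : EuclideanSpace ℝ (Fin n) => y k) x = EuclideanSpace.proj k :=
    (EuclideanSpace.proj (𝕜 := ℝ) k).hasFDerivAt.fderiv
  simp [partialDeriv, this]

theorem partialDeriv_comp (i : Fin n) {F : ℝ → ℝ} {F' : ℝ} (hF : HasDerivAt F F' (g x))
    (hg : DifferentiableAt ℝ g x) :
    partialDeriv i (fun y => F (g y)) x = F' * partialDeriv i g x := by
  have := (hF.comp_hasFDerivAt x hg.hasFDerivAt).fderiv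
  simp only [Function.comp_def] at this
  simp [partialDeriv, this]

theorem partialDeriv_comm (hg : ContDiff ℝ (⊤ : ℕ∞) g) (i j : Fin n) :
    partialDeriv i (partialDeriv j g) x = partialDeriv j (partialDeriv i g) x := by
  have hd : DifferentiableAt ℝ (fderiv ℝ g) x :=
    ((hg.fderiv_right (m := (⊤ : ℕ∞)) (by simp)).differentiable (by simp)).differentiableAt
  have key (a b : Fin n) : partialDeriv a (partialDeriv b g) x
      = fderiv ℝ (fderiv ℝ g) x (EuclideanSpace.single a 1) (EuclideanSpace.single b 1) := by
    change fderiv ℝ (fun y => fderiv ℝ g y (EuclideanSpace.single b 1)) x _ = _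
    rw [fderiv_clm_apply hd (differentiableAt_const _)]
    simp
  rw [key, key]
  have h2 : ContDiff ℝ 2 g := hg.of_le (WithTop.coe_le_coe.2 (le_top : (2 : ℕ∞) ≤ ⊤))
  exact (h2.contDiffAt.isSymmSndFDerivAt (by simp)) _ _

theorem fderiv_apply_eq_sum_partialDeriv (v : EuclideanSpace ℝ (Fin n)) :
    fderiv ℝ g x v = ∑ i, partialDeriv i g x * v i := by
  conv_lhs => rw [← (EuclideanSpace.basisFun (Fin n) ℝ).sum_repr v]
  simp [partialDeriv, mul_comm]

end PartialDeriv

section DivergenceTheorem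

variable {n : ℕ} {M : Set (EuclideanSpace ℝ (Fin n))}
  {σ : Measure (EuclideanSpace ℝ (Fin n))}
  {ν : EuclideanSpace ℝ (Fin n) → EuclideanSpace ℝ (Fin n)}

theorem Continuous.integrableOn_of_isBounded (hMbdd : Bornology.IsBounded M)
    {g : EuclideanSpace ℝ (Fin n) → ℝ} (hg : Continuous g) : IntegrableOn g M :=
  (hg.continuousOn.integrableOn_compact hMbdd.isCompact_closure).mono_set subset_closure

/-- The divergence theorem for a vector field given by its components. -/
theorem gauss_components
    (hGauss : ∀ G : EuclideanSpace ℝ (Fin n) → EuclideanSpace ℝ (Fin n),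
      ContDiff ℝ (⊤ : ℕ∞) G → ∫ x in M, eDiv G x = ∫ x, ⟪G x, ν x⟫ ∂σ)
    {g : Fin n → EuclideanSpace ℝ (Fin n) → ℝ} (hg : ∀ i, ContDiff ℝ (⊤ : ℕ∞) (g i)) :
    ∫ x in M, ∑ i, partialDeriv i (g i) x = ∫ x, ∑ i, g i x * ν x i ∂σ := by
  have := hGauss (fun x => WithLp.toLp 2 fun i => g i x) (contDiff_euclidean.2 hg)
  simpa [eDiv, partialDeriv, PiLp.inner_apply, mul_comm] using this

/-- The divergence theorem for a vector field with a single nonzero component. -/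
theorem gauss_single
    (hGauss : ∀ G : EuclideanSpace ℝ (Fin n) → EuclideanSpace ℝ (Fin n),
      ContDiff ℝ (⊤ : ℕ∞) G → ∫ x in M, eDiv G x = ∫ x, ⟪G x, ν x⟫ ∂σ)
    {g : EuclideanSpace ℝ (Fin n) → ℝ} (hg : ContDiff ℝ (⊤ : ℕ∞) g) (i : Fin n) :
    ∫ x in M, partialDeriv i g x = ∫ x, g x * ν x i ∂σ := by
  have := gauss_components hGauss (g := fun k x => (if k = i then 1 else 0) * g x)
    fun k => contDiff_const.mul hg
  simp only [partialDeriv_const_mul _ _ (hg.differentiable (by simp)).differentiableAt] at this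
  simpa using this

/-- The divergence theorem forces the components of the normal to be integrable: the fields
`x i` and `x i + 1` have nonzero flux, so their boundary integrands are integrable. -/
theorem integrable_normal
    (hMopen : IsOpen M) (hMbdd : Bornology.IsBounded M) (hσsupp : σ (frontier M)ᶜ = 0)
    (hGauss : ∀ G : EuclideanSpace ℝ (Fin n) → EuclideanSpace ℝ (Fin n),
      ContDiff ℝ (⊤ : ℕ∞) G → ∫ x in M, eDiv G x = ∫ x, ⟪G x, ν x⟫ ∂σ) (i : Fin n) :
    Integrable (fun x => ν x i) σ := by
  rcases M.eq_empty_or_nonempty with rfl | hne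
  · have : σ = 0 := by simpa using hσsupp
    simp [this]
  have hvol : volume.real M ≠ 0 :=
    (ENNReal.toReal_pos (hMopen.measure_pos volume hne).ne' hMbdd.measure_lt_top.ne).ne'
  have key (c : ℝ) : Integrable (fun x => (x i + c) * ν x i) σ := by
    by_contra hc
    have h := gauss_single hGauss ((contDiff_coord i).add (contDiff_const (c := c))) i
    rw [integral_undef hc] at h
    have hd (x : EuclideanSpace ℝ (Fin n)) : partialDeriv i (fun y => y i + c) x = 1 := by
      rw [partialDeriv_add _ ((contDiff_coord i).differentiable (by simp)).differentiableAt
        (differentiableAt_const _), partialDeriv_coord]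
      simp [partialDeriv]
    simp [hd, hvol] at h
  refine ((key 1).sub (key 0)).congr (.of_forall fun x => ?_)
  simp only [Pi.sub_apply]
  ring

theorem ae_mem_frontier (hσsupp : σ (frontier M)ᶜ = 0) : ∀ᵐ x ∂σ, x ∈ frontier M :=
  mem_ae_iff.2 hσsupp

theorem integrable_mul_normal
    (hMopen : IsOpen M) (hMbdd : Bornology.IsBounded M) (hσsupp : σ (frontier M)ᶜ = 0)
    (hGauss : ∀ G : EuclideanSpace ℝ (Fin n) → EuclideanSpace ℝ (Fin n),
      ContDiff ℝ (⊤ : ℕ∞) G → ∫ x in M, eDiv G x = ∫ x, ⟪G x, ν x⟫ ∂σ)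
    {g : EuclideanSpace ℝ (Fin n) → ℝ} (hg : Continuous g) (i : Fin n) :
    Integrable (fun x => g x * ν x i) σ := by
  obtain ⟨C, hC⟩ := hMbdd.isCompact_closure.exists_bound_of_continuousOn hg.continuousOn
  refine (integrable_normal hMopen hMbdd hσsupp hGauss i).bdd_mul (c := C)
    hg.aestronglyMeasurable ?_
  filter_upwards [ae_mem_frontier hσsupp] with x hx using hC x (frontier_subset_closure hx)

/-- The gradient of a function vanishing on the boundary is parallel to the normal. -/
theorem ae_partialDeriv_mul_normal_comm
    (hMopen : IsOpen M) (hMbdd : Bornology.IsBounded M) (hσsupp : σ (frontier M)ᶜ = 0)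
    (hGauss : ∀ G : EuclideanSpace ℝ (Fin n) → EuclideanSpace ℝ (Fin n),
      ContDiff ℝ (⊤ : ℕ∞) G → ∫ x in M, eDiv G x = ∫ x, ⟪G x, ν x⟫ ∂σ)
    {u : EuclideanSpace ℝ (Fin n) → ℝ} (hu : ContDiff ℝ (⊤ : ℕ∞) u)
    (hub : ∀ x ∈ frontier M, u x = 0) (i j : Fin n) :
    ∀ᵐ x ∂σ, partialDeriv j u x * ν x i = partialDeriv i u x * ν x j := by
  have hint {g : EuclideanSpace ℝ (Fin n) → ℝ} (hg : ContDiff ℝ (⊤ : ℕ∞) g) (k : Fin n) :=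
    integrable_mul_normal hMopen hMbdd hσsupp hGauss hg.continuous k
  have hdiff {g : EuclideanSpace ℝ (Fin n) → ℝ} (hg : ContDiff ℝ (⊤ : ℕ∞) g)
      (x : EuclideanSpace ℝ (Fin n)) : DifferentiableAt ℝ g x :=
    (hg.differentiable (by simp)).differentiableAt
  have hM {g : EuclideanSpace ℝ (Fin n) → ℝ} (hg : ContDiff ℝ (⊤ : ℕ∞) g) (k : Fin n) :
      IntegrableOn (partialDeriv k g) M :=
    (contDiff_partialDeriv hg k).continuous.integrableOn_of_isBounded hMbdd
  have hp (k : Fin n) := contDiff_partialDeriv hu k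
  have hzero : ∀ᵐ x ∂σ, partialDeriv j u x * ν x i - partialDeriv i u x * ν x j = 0 := by
    refine ae_eq_zero_of_integral_contDiff_smul_eq_zero
      ((hint (hp j) i).sub (hint (hp i) j)).locallyIntegrable fun φ hφ _ => ?_
    have hq (k : Fin n) := contDiff_partialDeriv hφ k
    have hboundary (k l : Fin n) : ∫ x in M, partialDeriv k (fun y => u y * partialDeriv l φ y) x
        = 0 := by
      rw [gauss_single hGauss (hu.mul (hq l))]
      refine integral_eq_zero_of_ae ?_
      filter_upwards [ae_mem_frontier hσsupp] with x hx
      simp [hub x hx]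
    calc ∫ x, φ x • (partialDeriv j u x * ν x i - partialDeriv i u x * ν x j) ∂σ
        = (∫ x, φ x * partialDeriv j u x * ν x i ∂σ)
            - ∫ x, φ x * partialDeriv i u x * ν x j ∂σ := by
          rw [← integral_sub (hint (hφ.mul (hp j)) i) (hint (hφ.mul (hp i)) j)]
          simp only [smul_eq_mul]
          congr 1 with x
          ring
      _ = (∫ x in M, partialDeriv i (fun y => φ y * partialDeriv j u y) x)
            - ∫ x in M, partialDeriv j (fun y => φ y * partialDeriv i u y) x := by
          rw [gauss_single hGauss (hφ.mul (hp j)), gauss_single hGauss (hφ.mul (hp i))]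
      _ = (∫ x in M, partialDeriv j (fun y => u y * partialDeriv i φ y) x)
            - ∫ x in M, partialDeriv i (fun y => u y * partialDeriv j φ y) x := by
          rw [← integral_sub (hM (hφ.mul (hp j)) i) (hM (hφ.mul (hp i)) j),
            ← integral_sub (hM (hu.mul (hq i)) j) (hM (hu.mul (hq j)) i)]
          congr 1 with x
          rw [partialDeriv_mul _ (hdiff hφ x) (hdiff (hp j) x),
            partialDeriv_mul _ (hdiff hφ x) (hdiff (hp i) x),
            partialDeriv_mul _ (hdiff hu x) (hdiff (hq i) x),
            partialDeriv_mul _ (hdiff hu x) (hdiff (hq j) x),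
            partialDeriv_comm hu i j, partialDeriv_comm hφ i j]
          ring
      _ = 0 := by rw [hboundary, hboundary, sub_zero]
  filter_upwards [hzero] with x hx using sub_eq_zero.1 hx

end DivergenceTheorem

theorem contDiff_primitive {f F : ℝ → ℝ} (hf : ContDiff ℝ (⊤ : ℕ∞) f)
    (hF : ∀ s, HasDerivAt F (f s) s) : ContDiff ℝ (⊤ : ℕ∞) F := by
  rw [contDiff_infty_iff_deriv]
  exact ⟨fun s => (hF s).differentiableAt, by rwa [funext fun s => (hF s).deriv]⟩

/-- The `i`-th component of the Pohozaev vector field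
`(x·∇u) ∇u - |∇u|²/2 x + λ F(u) x + (n-2)/2 u ∇u`. -/
noncomputable def pohozaevField {n : ℕ} (u : EuclideanSpace ℝ (Fin n) → ℝ) (F : ℝ → ℝ)
    (lam : ℝ) (i : Fin n) (x : EuclideanSpace ℝ (Fin n)) : ℝ :=
  (∑ k, x k * partialDeriv k u x) * partialDeriv i u x
    + (-(1 / 2) * ∑ k, partialDeriv k u x * partialDeriv k u x) * x i
    + lam * F (u x) * x i + ((n : ℝ) - 2) / 2 * (u x * partialDeriv i u x)

section Pohozaev

variable {n : ℕ} {u : EuclideanSpace ℝ (Fin n) → ℝ} {f F : ℝ → ℝ} {lam : ℝ}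

theorem contDiff_pohozaevField (hu : ContDiff ℝ (⊤ : ℕ∞) u) (hF : ContDiff ℝ (⊤ : ℕ∞) F)
    (i : Fin n) : ContDiff ℝ (⊤ : ℕ∞) (pohozaevField u F lam i) := by
  have hp (k : Fin n) := contDiff_partialDeriv hu k
  have hc (k : Fin n) := contDiff_coord k
  exact ((((ContDiff.sum fun k _ => (hc k).mul (hp k)).mul (hp i)).add
    ((contDiff_const.mul (ContDiff.sum fun k _ => (hp k).mul (hp k))).mul (hc i))).add
    ((contDiff_const.mul (hF.comp hu)).mul (hc i))).add (contDiff_const.mul (hu.mul (hp i)))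

theorem sum_partialDeriv_pohozaevField (hu : ContDiff ℝ (⊤ : ℕ∞) u)
    (hF : ∀ s, HasDerivAt F (f s) s) {x : EuclideanSpace ℝ (Fin n)}
    (hx : eLap u x + lam * f (u x) = 0) :
    ∑ i, partialDeriv i (pohozaevField u F lam i) x
      = lam * n * F (u x) + (2 - (n : ℝ)) / 2 * lam * (f (u x) * u x) := by
  have hdu : DifferentiableAt ℝ u x := (hu.differentiable (by simp)).differentiableAt
  have hdF : DifferentiableAt ℝ (fun y => F (u y)) x :=
    (hF (u x)).differentiableAt.comp x hdu
  have hdp (k : Fin n) : DifferentiableAt ℝ (partialDeriv k u) x :=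
    ((contDiff_partialDeriv hu k).differentiable (by simp)).differentiableAt
  have hdc (k : Fin n) : DifferentiableAt ℝ (fun y : EuclideanSpace ℝ (Fin n) => y k) x :=
    ((contDiff_coord k).differentiable (by simp)).differentiableAt
  have hdcp : DifferentiableAt ℝ (fun y => ∑ k, y k * partialDeriv k u y) x :=
    DifferentiableAt.fun_sum fun k _ => (hdc k).mul (hdp k)
  have hdpp : DifferentiableAt ℝ (fun y => ∑ k, partialDeriv k u y * partialDeriv k u y) x :=
    DifferentiableAt.fun_sum fun k _ => (hdp k).mul (hdp k)
  have hlap : ∑ i, partialDeriv i (partialDeriv i u) x = -(lam * f (u x)) :=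
    eq_neg_of_add_eq_zero_left hx
  have hcomp (i : Fin n) : partialDeriv i (pohozaevField u F lam i) x
      = (∑ k, x k * partialDeriv k u x) * partialDeriv i (partialDeriv i u) x
        + (∑ k, x k * partialDeriv i (partialDeriv k u) x * partialDeriv i u x
          - ∑ k, x i * partialDeriv i (partialDeriv k u) x * partialDeriv k u x)
        + lam * f (u x) * (x i * partialDeriv i u x)
        + (lam * F (u x) - 1 / 2 * ∑ k, partialDeriv k u x * partialDeriv k u x)
        + n / 2 * (partialDeriv i u x * partialDeriv i u x)
        + ((n : ℝ) - 2) / 2 * u x * partialDeriv i (partialDeriv i u) x := by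
    have h1 : partialDeriv i (fun y => ∑ k, y k * partialDeriv k u y) x
        = ∑ k, x k * partialDeriv i (partialDeriv k u) x + partialDeriv i u x := by
      rw [partialDeriv_sum _ _ fun k => (hdc k).fun_mul (hdp k)]
      simp [partialDeriv_mul _ (hdc _) (hdp _), partialDeriv_coord, Finset.sum_add_distrib]
    have h2 : partialDeriv i (fun y => ∑ k, partialDeriv k u y * partialDeriv k u y) x
        = 2 * ∑ k, partialDeriv i (partialDeriv k u) x * partialDeriv k u x := by
      rw [partialDeriv_sum _ _ fun k => (hdp k).fun_mul (hdp k), Finset.mul_sum]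
      refine Finset.sum_congr rfl fun k _ => ?_
      rw [partialDeriv_mul _ (hdp k) (hdp k)]
      ring
    have h3 : ∑ k, x i * partialDeriv i (partialDeriv k u) x * partialDeriv k u x
        = x i * ∑ k, partialDeriv i (partialDeriv k u) x * partialDeriv k u x := by
      simp [Finset.mul_sum, mul_assoc]
    unfold pohozaevField
    rw [partialDeriv_add _
        (((hdcp.fun_mul (hdp i)).fun_add ((hdpp.const_mul _).fun_mul (hdc i))).fun_add
          ((hdF.const_mul _).fun_mul (hdc i)))
        ((hdu.fun_mul (hdp i)).const_mul _),
      partialDeriv_add _ ((hdcp.fun_mul (hdp i)).fun_add ((hdpp.const_mul _).fun_mul (hdc i)))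
        ((hdF.const_mul _).fun_mul (hdc i)),
      partialDeriv_add _ (hdcp.fun_mul (hdp i)) ((hdpp.const_mul _).fun_mul (hdc i)),
      partialDeriv_mul _ hdcp (hdp i), partialDeriv_mul _ (hdpp.const_mul _) (hdc i),
      partialDeriv_const_mul _ _ hdpp, partialDeriv_mul _ (hdF.const_mul _) (hdc i),
      partialDeriv_const_mul _ _ hdF, partialDeriv_comp _ (hF _) hdu,
      partialDeriv_const_mul _ _ (hdu.fun_mul (hdp i)), partialDeriv_mul _ hdu (hdp i),
      h1, h2, h3, partialDeriv_coord, if_pos rfl, ← Finset.sum_mul]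
    ring
  have hswap : ∑ i, ∑ k, x k * partialDeriv i (partialDeriv k u) x * partialDeriv i u x
      = ∑ i, ∑ k, x i * partialDeriv i (partialDeriv k u) x * partialDeriv k u x := by
    rw [Finset.sum_comm]
    refine Finset.sum_congr rfl fun i _ => Finset.sum_congr rfl fun k _ => ?_
    rw [partialDeriv_comm hu]
  simp only [hcomp, Finset.sum_add_distrib, Finset.sum_sub_distrib, hswap, ← Finset.mul_sum,
    hlap, Finset.sum_const, Finset.card_univ, Fintype.card_fin, nsmul_eq_mul]
  ring

/-- On the boundary the flux of the Pohozaev field is `(x·ν) (∂_ν u)² / 2`. -/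
theorem sum_pohozaevField_mul_normal {x v : EuclideanSpace ℝ (Fin n)} (hux : u x = 0)
    (hF0 : F 0 = 0) (hv : ‖v‖ = 1)
    (hpar : ∀ i j, partialDeriv j u x * v i = partialDeriv i u x * v j) :
    ∑ i, pohozaevField u F lam i x * v i
      = 1 / 2 * (⟪x, v⟫ * ⟪gradient u x, v⟫ ^ 2) := by
  set d := ∑ i, partialDeriv i u x * v i with hd
  have hnorm : ∑ i, v i * v i = 1 := by
    have := EuclideanSpace.real_norm_sq_eq v
    rw [hv] at this
    simpa [pow_two] using this.symm
  have hgrad (j : Fin n) : partialDeriv j u x = d * v j := by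
    calc partialDeriv j u x = ∑ i, partialDeriv j u x * v i * v i := by
          simp only [mul_assoc, ← Finset.mul_sum, hnorm, mul_one]
      _ = d * v j := by
          rw [hd, Finset.sum_mul]
          refine Finset.sum_congr rfl fun i _ => ?_
          rw [hpar i j]
          ring
  have hsq : ∑ k, partialDeriv k u x * partialDeriv k u x = d ^ 2 := by
    calc _ = ∑ k, d ^ 2 * (v k * v k) := by
          refine Finset.sum_congr rfl fun k _ => ?_
          rw [hgrad k]
          ring
      _ = d ^ 2 := by rw [← Finset.mul_sum, hnorm, mul_one]
  have hxd : ∑ k, x k * partialDeriv k u x = d * ⟪x, v⟫ := by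
    rw [PiLp.inner_apply, Finset.mul_sum]
    refine Finset.sum_congr rfl fun k _ => ?_
    rw [hgrad k]
    simp
    ring
  have hxv : ∑ k, x k * v k = ⟪x, v⟫ := by
    simp [PiLp.inner_apply, mul_comm]
  rw [inner_gradient_left, fderiv_apply_eq_sum_partialDeriv, ← hd]
  calc ∑ i, pohozaevField u F lam i x * v i
      = ∑ i, (d * ⟪x, v⟫ * (partialDeriv i u x * v i) - 1 / 2 * d ^ 2 * (x i * v i)) := by
        refine Finset.sum_congr rfl fun i _ => ?_
        rw [pohozaevField, hsq, hxd, hux, hF0]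
        ring
    _ = 1 / 2 * (⟪x, v⟫ * d ^ 2) := by
        rw [Finset.sum_sub_distrib, ← Finset.mul_sum, ← Finset.mul_sum, ← hd, hxv]
        ring

end Pohozaev

/-- the classical Pohozaev identity: Let `M ⊂ ℝⁿ` be a bounded
domain with smooth boundary and `u` a smooth function with `u = 0` on `∂M`
satisfying `Δu + λ f(u) = 0` in `M`, where `f` is smooth with `f(0) = 0` and
`F(s) = ∫₀ˢ f(t) dt`.  Then
`λ n ∫_M F(u) + ((2−n)/2) λ ∫_M f(u) u = (1/2) ∫_{∂M} (x·ν)(∂_ν u)² dσ`,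
where `x` is the position (Euler) vector field and `ν` the outward unit normal.
The boundary surface measure `σ` and outward normal `ν` are characterized by the
divergence theorem, which is axiomatized as a hypothesis. -/
theorem stmt_17
    {n : ℕ} (hn : 1 ≤ n)
    (M : Set (EuclideanSpace ℝ (Fin n)))
    (hMopen : IsOpen M) (hMbdd : Bornology.IsBounded M)
    (σ : Measure (EuclideanSpace ℝ (Fin n)))        -- boundary surface measure dσ
    (hσsupp : σ (frontier M)ᶜ = 0)                  -- σ lives on ∂M
    (ν : EuclideanSpace ℝ (Fin n) → EuclideanSpace ℝ (Fin n))  -- outward unit normal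
    (hνunit : ∀ x ∈ frontier M, ‖ν x‖ = 1)
    -- divergence theorem characterizing σ and ν (smooth boundary)
    (hGauss : ∀ G : EuclideanSpace ℝ (Fin n) → EuclideanSpace ℝ (Fin n),
      ContDiff ℝ (⊤ : ℕ∞) G → ∫ x in M, eDiv G x = ∫ x, ⟪G x, ν x⟫ ∂σ)
    (u : EuclideanSpace ℝ (Fin n) → ℝ) (hu : ContDiff ℝ (⊤ : ℕ∞) u)
    (hub : ∀ x ∈ frontier M, u x = 0)               -- u = 0 on ∂M
    (f : ℝ → ℝ) (hf : ContDiff ℝ (⊤ : ℕ∞) f) (hf0 : f 0 = 0)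
    (lam : ℝ)
    (hPDE : ∀ x ∈ M, eLap u x + lam * f (u x) = 0)  -- Δu + λ f(u) = 0 in M
    (F : ℝ → ℝ) (hF : ∀ s : ℝ, F s = ∫ t in (0:ℝ)..s, f t) :
    lam * (n : ℝ) * (∫ x in M, F (u x)) +
        ((2 - (n : ℝ)) / 2) * lam * (∫ x in M, f (u x) * u x)
      = (1 / 2) * ∫ x, ⟪x, ν x⟫ * (⟪gradient u x, ν x⟫) ^ 2 ∂σ := by
  have hFderiv (s : ℝ) : HasDerivAt F (f s) s := by
    rw [funext hF]
    exact intervalIntegral.integral_hasDerivAt_right (hf.continuous.intervalIntegrable _ _)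
      (hf.continuous.stronglyMeasurableAtFilter _ _) hf.continuous.continuousAt
  have hFsmooth := contDiff_primitive hf hFderiv
  have hF0 : F 0 = 0 := by simp [hF]
  have hintF : IntegrableOn (fun x => F (u x)) M :=
    (hFsmooth.continuous.comp hu.continuous).integrableOn_of_isBounded hMbdd
  have hintf : IntegrableOn (fun x => f (u x) * u x) M :=
    ((hf.continuous.comp hu.continuous).mul hu.continuous).integrableOn_of_isBounded hMbdd
  have hpar : ∀ᵐ x ∂σ, ∀ i j, partialDeriv j u x * ν x i = partialDeriv i u x * ν x j := by
    simp only [ae_all_iff]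
    exact ae_partialDeriv_mul_normal_comm hMopen hMbdd hσsupp hGauss hu hub
  calc lam * (n : ℝ) * (∫ x in M, F (u x)) +
        ((2 - (n : ℝ)) / 2) * lam * (∫ x in M, f (u x) * u x)
      = ∫ x in M, lam * n * F (u x) + (2 - (n : ℝ)) / 2 * lam * (f (u x) * u x) := by
        rw [integral_add (hintF.const_mul _) (hintf.const_mul _), integral_const_mul,
          integral_const_mul]
    _ = ∫ x in M, ∑ i, partialDeriv i (pohozaevField u F lam i) x :=
        setIntegral_congr_fun hMopen.measurableSet fun x hx =>
          (sum_partialDeriv_pohozaevField hu hFderiv (hPDE x hx)).symm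
    _ = ∫ x, ∑ i, pohozaevField u F lam i x * ν x i ∂σ :=
        gauss_components hGauss (contDiff_pohozaevField hu hFsmooth)
    _ = (1 / 2) * ∫ x, ⟪x, ν x⟫ * (⟪gradient u x, ν x⟫) ^ 2 ∂σ := by
        rw [← integral_const_mul]
        refine integral_congr_ae ?_
        filter_upwards [hpar, ae_mem_frontier hσsupp] with x hx hxM
        exact sum_pohozaevField_mul_normal (hub x hxM) hF0 (hνunit x hxM) hx
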